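/- arXiv:2302.09666 — 2 statements merged into one kernel-verified Lean document; each statement's English description precedes it below -/
import Mathlib

section
/- Let A₁, …, A_k be jointly refluent canonical command sets. A subset M ⊆ A₁ ∪ ⋯ ∪ A_k is a merger of A₁, …, A_k if and only if M is maximal under inclusion among subsets of A₁ ∪ ⋯ ∪ A_k containing no two commands in conflict. -/
namespace FileSync

/-- A filesystem value: a directory, the empty value, or a file with content from `C`. -/
inductive Val (C : Type) : Type where
  | dir : Val C
  | empty : Val C
  | file : C → Val C

/-- The type of a value, ordered E < F < D via 0 < 1 < 2. -/
def vtype {C : Type} : Val C → ℕ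
  | Val.empty => 0
  | Val.file _ => 1
  | Val.dir => 2

/-- A node is a nonempty finite sequence of names. -/
abbrev Node (N : Type) : Type := { l : List N // l ≠ ([] : List N) }

/-- `Anc m n`: `m` is a proper ancestor of (strictly above) `n`. -/
def Anc {N : Type} (m n : Node N) : Prop := m.1 <+: n.1 ∧ m ≠ n

/-- Two nodes are comparable if one is a prefix of the other. -/
def NodesComparable {N : Type} (m n : Node N) : Prop := m.1 <+: n.1 ∨ n.1 <+: m.1

/-- `IsParent p n`: `p` is the parent of `n` (removing the last name of `n` gives `p`). -/
def IsParent {N : Type} (p n : Node N) : Prop := ∃ a : N, n.1 = p.1 ++ [a]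

/-- A command: a node, an input value (precondition) and an output value. -/
structure Cmd (N C : Type) where
  node : Node N
  inp : Val C
  out : Val C

variable {N C : Type} [DecidableEq N]

/-- A valid filesystem: finitely many non-empty nodes, and the tree property. -/
def ValidFS (f : Node N → Val C) : Prop :=
  {n : Node N | f n ≠ Val.empty}.Finite ∧
  ∀ n m : Node N, Anc m n → f n ≠ Val.empty → f m = Val.dir

/-- Replace the value at the node of `σ` by its output value. -/
def upd (f : Node N → Val C) (σ : Cmd N C) : Node N → Val C :=
  fun m => if m = σ.node then σ.out else f m

/-- `SeqOK α f`: the command sequence `α` does not break the filesystem `f`: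
each command finds its input value and yields a valid filesystem. -/
def SeqOK : List (Cmd N C) → (Node N → Val C) → Prop
  | [], _ => True
  | σ :: rest, f => f σ.node = σ.inp ∧ ValidFS (upd f σ) ∧ SeqOK rest (upd f σ)

/-- The result of applying a command sequence (left to right). -/
def applySeq : List (Cmd N C) → (Node N → Val C) → (Node N → Val C)
  | [], f => f
  | σ :: rest, f => applySeq rest (upd f σ)

/-- A sequence is non-breaking if there is at least one filesystem it does not break. -/
def NonBreaking (α : List (Cmd N C)) : Prop := ∃ f, ValidFS f ∧ SeqOK α f

/-- Semantic equivalence: on every filesystem both break, or both yield the same result. -/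
def SeqEquiv (α β : List (Cmd N C)) : Prop :=
  ∀ f, ValidFS f → ((SeqOK α f ↔ SeqOK β f) ∧ (SeqOK α f → applySeq α f = applySeq β f))

/-- `SeqExt α β`: `β` semantically extends `α` (`α ≤ β`). -/
def SeqExt (α β : List (Cmd N C)) : Prop :=
  ∀ f, ValidFS f → SeqOK α f → SeqOK β f ∧ applySeq β f = applySeq α f

/-- The `≪` relation between commands on child–parent or parent–child nodes. -/
def LL (σ τ : Cmd N C) : Prop :=
  (IsParent τ.node σ.node ∧ σ.out = Val.empty ∧ σ.inp ≠ Val.empty ∧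
      τ.inp = Val.dir ∧ τ.out ≠ Val.dir) ∨
  (IsParent σ.node τ.node ∧ σ.out = Val.dir ∧ σ.inp ≠ Val.dir ∧
      τ.inp = Val.empty ∧ τ.out ≠ Val.empty)

/-- A canonical command set: finite, no null commands, at most one command per node,
`≪`-connected (commands on distinct comparable nodes are joined by a `≪`-chain in the set). -/
def Canonical (A : Set (Cmd N C)) : Prop :=
  A.Finite ∧
  (∀ σ ∈ A, σ.inp ≠ σ.out) ∧
  (∀ σ ∈ A, ∀ τ ∈ A, σ.node = τ.node → σ = τ) ∧
  (∀ σ ∈ A, ∀ τ ∈ A, σ.node ≠ τ.node → NodesComparable σ.node τ.node →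
    Relation.ReflTransGen (fun a b => a ∈ A ∧ b ∈ A ∧ LL a b) σ τ ∨
    Relation.ReflTransGen (fun a b => a ∈ A ∧ b ∈ A ∧ LL a b) τ σ)

/-- A sequence honors `≪`: whenever `σ ≪ τ` for members, `σ` precedes `τ`. -/
def Honors (α : List (Cmd N C)) : Prop :=
  ∀ σ ∈ α, ∀ τ ∈ α, LL σ τ → List.Sublist [σ, τ] α

/-- A canonical sequence: its commands form a canonical set and it honors `≪`. -/
def CanonicalSeq (α : List (Cmd N C)) : Prop :=
  α.Nodup ∧ Canonical {σ : Cmd N C | σ ∈ α} ∧ Honors α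

/-- `Orders A α`: the sequence `α` is an arrangement of the set `A` honoring `≪`. -/
def Orders (A : Set (Cmd N C)) (α : List (Cmd N C)) : Prop :=
  α.Nodup ∧ (∀ σ : Cmd N C, σ ∈ α ↔ σ ∈ A) ∧ Honors α

/-- The action of a canonical set: `A` does not break `f`
(some `≪`-honoring arrangement exists, and every such arrangement works on `f`). -/
def SetNoBreak (A : Set (Cmd N C)) (f : Node N → Val C) : Prop :=
  (∃ α, Orders A α) ∧ ∀ α, Orders A α → SeqOK α f

/-- `SetApp A f g`: applying the set `A` (in any `≪`-honoring order) to `f` yields `g`. -/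
def SetApp (A : Set (Cmd N C)) (f g : Node N → Val C) : Prop :=
  SetNoBreak A f ∧ ∀ α, Orders A α → applySeq α f = g

/-- The set `S` has a command on node `n`. -/
def Mentions (S : Set (Cmd N C)) (n : Node N) : Prop := ∃ ρ ∈ S, ρ.node = n

/-- Two canonical sets are refluent if some filesystem is broken by neither. -/
def Refluent (A B : Set (Cmd N C)) : Prop :=
  ∃ f, ValidFS f ∧ SetNoBreak A f ∧ SetNoBreak B f

/-- Canonical sets are jointly refluent if a single filesystem is broken by none of them. -/
def JointlyRefluent {k : ℕ} (A : Fin k → Set (Cmd N C)) : Prop :=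
  ∃ f, ValidFS f ∧ ∀ i, SetNoBreak (A i) f

/-- Two distinct commands are in conflict if they are on the same node, or one is on a
proper ancestor node, creates a non-directory, and the lower one creates non-empty content. -/
def Conflict (σ τ : Cmd N C) : Prop :=
  σ ≠ τ ∧ (σ.node = τ.node ∨
    (Anc σ.node τ.node ∧ σ.out ≠ Val.dir ∧ τ.out ≠ Val.empty) ∨
    (Anc τ.node σ.node ∧ τ.out ≠ Val.dir ∧ σ.out ≠ Val.empty))

/-- A merger: a maximal canonical subset of `⋃ i, A i`. -/
def Merger {k : ℕ} (A : Fin k → Set (Cmd N C)) (M : Set (Cmd N C)) : Prop :=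
  M ⊆ (⋃ i, A i) ∧ Canonical M ∧
  ∀ M' : Set (Cmd N C), M ⊆ M' → M' ⊆ (⋃ i, A i) → Canonical M' → M' = M

/-- `B` is an initial segment of `A`: there is an `≪`-honoring arrangement of `A` in which
all commands of `B` precede all commands of `A \ B`. -/
def InitSeg (B A : Set (Cmd N C)) : Prop :=
  B ⊆ A ∧ ∃ α₁ α₂ : List (Cmd N C), Orders B α₁ ∧ Orders (A \ B) α₂ ∧ Orders A (α₁ ++ α₂)

/-- The inverse of a command. -/
def cinv (σ : Cmd N C) : Cmd N C := ⟨σ.node, σ.out, σ.inp⟩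

/-- The inverse of a sequence: inverses of its commands in reverse order. -/
def seqInv (α : List (Cmd N C)) : List (Cmd N C) := (α.map cinv).reverse

theorem seq_facts {N C : Type} [DecidableEq N] (α : List (Cmd N C)) :
    ∀ f : Node N → Val C, (α.map Cmd.node).Nodup → ValidFS f → SeqOK α f →
      ValidFS (applySeq α f) ∧
      (∀ σ ∈ α, f σ.node = σ.inp ∧ applySeq α f σ.node = σ.out) ∧
      (∀ n, n ∉ α.map Cmd.node → applySeq α f n = f n) := by
  induction α with
  | nil => intro f _ hv _; simp [applySeq, hv]
  | cons a l ih =>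
    intro f hn hv hs
    obtain ⟨h1, h2, h3⟩ := hs
    rw [List.map_cons, List.nodup_cons] at hn
    obtain ⟨g1, g2, g3⟩ := ih (upd f a) hn.2 h2 h3
    refine ⟨g1, ?_, ?_⟩
    · intro σ hσ
      rcases List.mem_cons.1 hσ with rfl | hσ
      · refine ⟨h1, ?_⟩
        show applySeq l (upd f σ) σ.node = σ.out
        rw [g3 _ hn.1]; simp [upd]
      · obtain ⟨k1, k2⟩ := g2 σ hσ
        refine ⟨?_, k2⟩
        have : σ.node ≠ a.node := by
          intro h; apply hn.1; rw [← h]; exact List.mem_map_of_mem hσ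
        simpa [upd, this] using k1
    · intro n hn'
      rw [List.map_cons, List.mem_cons, not_or] at hn'
      show applySeq l (upd f a) n = f n
      rw [g3 n hn'.2]; simp [upd, hn'.1]

theorem set_facts {N C : Type} [DecidableEq N] (A : Set (Cmd N C)) (hA : Canonical A)
    (f : Node N → Val C) (hv : ValidFS f) (hs : SetNoBreak A f) :
    ∃ g : Node N → Val C, ValidFS g ∧
      (∀ σ ∈ A, f σ.node = σ.inp ∧ g σ.node = σ.out) ∧
      (∀ n, g n ≠ f n → ∃ σ ∈ A, σ.node = n) := by
  obtain ⟨⟨α, hα⟩, h⟩ := hs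
  have hok := h α hα
  obtain ⟨hnd, hmem, -⟩ := hα
  have hn : (α.map Cmd.node).Nodup := by
    apply List.Nodup.map_on _ hnd
    intro x hx y hy hxy
    exact hA.2.2.1 x ((hmem x).1 hx) y ((hmem y).1 hy) hxy
  obtain ⟨g1, g2, g3⟩ := seq_facts α f hn hv hok
  refine ⟨_, g1, fun σ hσ => g2 σ ((hmem σ).2 hσ), ?_⟩
  intro n hne
  by_contra hcon
  apply hne
  apply g3
  intro hin
  obtain ⟨σ, hσ, rfl⟩ := List.mem_map.1 hin
  exact hcon ⟨σ, (hmem σ).1 hσ, rfl⟩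

theorem IsParent.pre {N : Type} {p n : Node N} (h : IsParent p n) : p.1 <+: n.1 := by
  obtain ⟨a, ha⟩ := h; exact ⟨[a], ha.symm⟩

theorem Anc.of_parent {N : Type} {p n : Node N} (h : IsParent p n) : Anc p n := by
  refine ⟨h.pre, ?_⟩
  rintro rfl
  obtain ⟨a, ha⟩ := h
  have := congrArg List.length ha
  simp at this

theorem Anc.length_lt {N : Type} {p n : Node N} (h : Anc p n) : p.1.length < n.1.length := by
  rcases lt_or_eq_of_le h.1.length_le with h1 | h1
  · exact h1
  · exact absurd (Subtype.ext (h.1.eq_of_length h1)) h.2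

theorem Anc.of_pre_anc {N : Type} {a b c : Node N} (h : a.1 <+: b.1) (h' : Anc b c) :
    Anc a c := by
  refine ⟨h.trans h'.1, ?_⟩
  rintro rfl
  have := h.length_le
  have := h'.length_lt
  omega

theorem Anc.of_anc_pre {N : Type} {a b c : Node N} (h : Anc a b) (h' : b.1 <+: c.1) :
    Anc a c := by
  refine ⟨h.1.trans h', ?_⟩
  rintro rfl
  have := h'.length_le
  have := h.length_lt
  omega

theorem reach_up {N C : Type} [DecidableEq N] {A : Set (Cmd N C)} {σ τ : Cmd N C}
    (h : Relation.ReflTransGen (fun a b => a ∈ A ∧ b ∈ A ∧ LL a b) σ τ)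
    (hσ : σ.out ≠ Val.dir) : τ.out ≠ Val.dir ∧ τ.node.1 <+: σ.node.1 := by
  induction h with
  | refl => exact ⟨hσ, List.prefix_refl _⟩
  | tail _ h2 ih =>
    rcases h2.2.2 with h | h
    · exact ⟨h.2.2.2.2, h.1.pre.trans ih.2⟩
    · exact absurd h.2.1 ih.1

theorem reach_down {N C : Type} [DecidableEq N] {A : Set (Cmd N C)} {σ τ : Cmd N C}
    (h : Relation.ReflTransGen (fun a b => a ∈ A ∧ b ∈ A ∧ LL a b) σ τ)
    (hσ : σ.out ≠ Val.empty) : τ.out ≠ Val.empty ∧ σ.node.1 <+: τ.node.1 := by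
  induction h with
  | refl => exact ⟨hσ, List.prefix_refl _⟩
  | tail _ h2 ih =>
    rcases h2.2.2 with h | h
    · exact absurd h.2.1 ih.1
    · exact ⟨h.2.2.2.2, ih.2.trans h.1.pre⟩

theorem canonical_anc {N C : Type} [DecidableEq N] {M : Set (Cmd N C)} (hM : Canonical M)
    {σ τ : Cmd N C} (hσ : σ ∈ M) (hτ : τ ∈ M) (h : Anc σ.node τ.node)
    (h1 : σ.out ≠ Val.dir) (h2 : τ.out ≠ Val.empty) : False := by
  have hl := h.length_lt
  rcases hM.2.2.2 σ hσ τ hτ h.2 (Or.inl h.1) with r | r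
  · have := (reach_up r h1).2.length_le
    omega
  · have := (reach_down r h2).2.length_le
    omega

theorem canonical_free {N C : Type} [DecidableEq N] {M : Set (Cmd N C)} (hM : Canonical M) :
    ∀ σ ∈ M, ∀ τ ∈ M, ¬ Conflict σ τ := by
  rintro σ hσ τ hτ ⟨hne, h | h | h⟩
  · exact hne (hM.2.2.1 σ hσ τ hτ h)
  · exact canonical_anc hM hσ hτ h.1 h.2.1 h.2.2
  · exact canonical_anc hM hτ hσ h.1 h.2.1 h.2.2

theorem chain {N C : Type} [DecidableEq N] {M : Set (Cmd N C)} {σ τ : Cmd N C}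
    (R : Cmd N C → Cmd N C → Prop) (hσ : σ ∈ M) (hτ : τ ∈ M)
    (huniq : ∀ σ ∈ M, ∀ τ ∈ M, σ.node = τ.node → σ = τ)
    (hst : Anc σ.node τ.node)
    (hex : ∀ n, Anc σ.node n → Anc n τ.node → ∃ ρ ∈ M, ρ.node = n)
    (hR : ∀ ρ ∈ M, ∀ ρ' ∈ M, σ.node.1 <+: ρ.node.1 → ρ'.node.1 <+: τ.node.1 →
      IsParent ρ.node ρ'.node → R ρ ρ') : Relation.ReflTransGen R σ τ := by
  have key : ∀ s : List N, σ.node.1 ++ s <+: τ.node.1 →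
      ∃ ρ ∈ M, ρ.node.1 = σ.node.1 ++ s ∧ Relation.ReflTransGen R σ ρ := by
    intro s
    induction s using List.reverseRecOn with
    | nil => intro _; exact ⟨σ, hσ, by simp, .refl⟩
    | append_singleton s a ih =>
      intro hp
      have hp0 : σ.node.1 ++ s <+: σ.node.1 ++ (s ++ [a]) := ⟨[a], by simp⟩
      obtain ⟨ρ, hρ, hn, hr⟩ := ih (hp0.trans hp)
      obtain ⟨ρ', hρ', hn'⟩ : ∃ ρ' ∈ M, ρ'.node.1 = σ.node.1 ++ (s ++ [a]) := by
        by_cases he : τ.node.1 = σ.node.1 ++ (s ++ [a])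
        · exact ⟨τ, hτ, he⟩
        · obtain ⟨ρ', h1, h2⟩ := hex ⟨σ.node.1 ++ (s ++ [a]), by simp⟩
            ⟨List.prefix_append _ _, fun h => by
              have := congrArg (fun x => x.1.length) h
              simp at this⟩
            ⟨hp, fun h => he (congrArg Subtype.val h).symm⟩
          exact ⟨ρ', h1, by rw [h2]⟩
      refine ⟨ρ', hρ', hn', hr.tail (hR ρ hρ ρ' hρ' ?_ ?_ ⟨a, ?_⟩)⟩
      · rw [hn]; exact List.prefix_append _ _
      · rw [hn']; exact hp
      · rw [hn, hn']; simp
  obtain ⟨s, hs⟩ := hst.1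
  obtain ⟨ρ, hρ, hn, hr⟩ := key s (by rw [hs])
  have : ρ = τ := huniq ρ hρ τ hτ (Subtype.ext (hn.trans hs))
  exact this ▸ hr

theorem maximal_canonical {N C : Type} [DecidableEq N] {k : ℕ} (A : Fin k → Set (Cmd N C))
    (hc : ∀ i, Canonical (A i)) (hr : JointlyRefluent A)
    (M : Set (Cmd N C)) (hM : M ⊆ ⋃ i, A i)
    (hfree : ∀ σ ∈ M, ∀ τ ∈ M, ¬ Conflict σ τ)
    (hmax : ∀ M' : Set (Cmd N C), M ⊆ M' → M' ⊆ (⋃ i, A i) →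
         (∀ σ ∈ M', ∀ τ ∈ M', ¬ Conflict σ τ) → M' = M) : Canonical M := by
  obtain ⟨f, hf, hA⟩ := hr
  have hg := fun i => set_facts (A i) (hc i) f hf (hA i)
  have hinp : ∀ σ ∈ ⋃ i, A i, f σ.node = σ.inp := by
    intro σ hσ
    obtain ⟨i, hi⟩ := Set.mem_iUnion.1 hσ
    obtain ⟨g, _, h, _⟩ := hg i
    exact (h σ hi).1
  have hnn : ∀ σ ∈ ⋃ i, A i, σ.inp ≠ σ.out := by
    intro σ hσ
    obtain ⟨i, hi⟩ := Set.mem_iUnion.1 hσ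
    exact (hc i).2.1 σ hi
  have huniq : ∀ σ ∈ M, ∀ τ ∈ M, σ.node = τ.node → σ = τ := by
    intro σ hσ τ hτ h
    by_contra hne
    exact hfree σ hσ τ hτ ⟨hne, Or.inl h⟩
  have hanc : ∀ σ ∈ M, ∀ τ ∈ M, Anc σ.node τ.node → σ.out ≠ Val.dir → τ.out ≠ Val.empty →
      False := by
    intro σ hσ τ hτ h h1 h2
    refine hfree σ hσ τ hτ ⟨?_, Or.inr (Or.inl ⟨h, h1, h2⟩)⟩
    rintro rfl
    exact h.2 rfl
  -- membership by maximality
  have hmem : ∀ ρ ∈ ⋃ i, A i, (∀ μ ∈ M, ¬ Conflict ρ μ) → ρ ∈ M := by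
    intro ρ hρ h
    have hsymm : ∀ a b : Cmd N C, Conflict a b → Conflict b a := by
      rintro a b ⟨h1, h2⟩
      refine ⟨h1.symm, ?_⟩
      rcases h2 with h2 | h2 | h2
      · exact Or.inl h2.symm
      · exact Or.inr (Or.inr h2)
      · exact Or.inr (Or.inl h2)
    have := hmax (insert ρ M) (Set.subset_insert _ _) (Set.insert_subset hρ hM) (by
      rintro σ (rfl | hσ) τ (rfl | hτ)
      · exact fun h => h.1 rfl
      · exact h τ hτ
      · exact fun h' => h σ hσ (hsymm _ _ h')
      · exact hfree σ hσ τ hτ)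
    rw [← this]; exact Set.mem_insert _ _
  have hext : ∀ a b : Cmd N C, a.node = b.node → a.inp = b.inp → a.out = b.out → a = b := by
    rintro ⟨_, _, _⟩ ⟨_, _, _⟩ h1 h2 h3
    simp only at h1 h2 h3
    subst h1 h2 h3
    rfl
  have main : ∀ σ ∈ M, ∀ τ ∈ M, Anc σ.node τ.node →
    Relation.ReflTransGen (fun a b => a ∈ M ∧ b ∈ M ∧ LL a b) σ τ ∨
    Relation.ReflTransGen (fun a b => a ∈ M ∧ b ∈ M ∧ LL a b) τ σ := by
    intro σ hσ τ hτ hst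
    by_cases hd : σ.out = Val.dir
    · left
      have hσi : f σ.node ≠ Val.dir := by
        rw [hinp σ (hM hσ), ← hd]; exact hnn σ (hM hσ)
      have hE : ∀ n, Anc σ.node n → f n = Val.empty := by
        intro n hn
        by_contra hne
        exact hσi (hf.2 n _ hn hne)
      have hτo : τ.out ≠ Val.empty := by
        have := hnn τ (hM hτ)
        rw [← hinp τ (hM hτ), hE _ hst] at this
        exact this.symm
      obtain ⟨i, hi⟩ := Set.mem_iUnion.1 (hM hτ)
      obtain ⟨g, gv, g1, g2⟩ := hg i
      refine chain _ hσ hτ huniq hst ?_ ?_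
      · intro n hn1 hn2
        have hgn : g n = Val.dir := gv.2 _ _ hn2 (by rw [(g1 τ hi).2]; exact hτo)
        obtain ⟨ρ, hρ, rfl⟩ := g2 n (by rw [hgn, hE n hn1]; simp)
        have hρU : ρ ∈ ⋃ i, A i := Set.mem_iUnion.2 ⟨i, hρ⟩
        have hρo : ρ.out = Val.dir := by rw [← (g1 ρ hρ).2, hgn]
        refine ⟨ρ, hmem ρ hρU ?_, rfl⟩
        rintro μ hμ ⟨hne, h | h | h⟩
        · apply hne
          apply hext _ _ h
          · rw [← hinp ρ hρU, ← hinp μ (hM hμ), h]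
          · rw [hρo]
            by_contra hcon
            exact hanc μ hμ τ hτ (h ▸ hn2) (Ne.symm hcon) hτo
        · exact h.2.1 hρo
        · exact hanc μ hμ τ hτ (Anc.of_pre_anc h.1.1 hn2) h.2.1 hτo
      · intro ρ hρ ρ' hρ' h1 h2 hp
        have ha' : Anc σ.node ρ'.node := Anc.of_pre_anc h1 (Anc.of_parent hp)
        have ha : Anc ρ.node τ.node := Anc.of_anc_pre (Anc.of_parent hp) h2
        have ho : ρ.out = Val.dir := by
          by_contra hcon
          exact hanc ρ hρ τ hτ ha hcon hτo
        have hi' : ρ'.inp = Val.empty := by rw [← hinp ρ' (hM hρ'), hE _ ha']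
        refine ⟨hρ, hρ', Or.inr ⟨hp, ho, ?_, hi', ?_⟩⟩
        · rw [← ho]; exact hnn ρ (hM hρ)
        · rw [← hi']; exact (hnn ρ' (hM hρ')).symm
    · right
      have hτo : τ.out = Val.empty := by
        by_contra hcon
        exact hanc σ hσ τ hτ hst hd hcon
      have hτi : f τ.node ≠ Val.empty := by
        rw [hinp τ (hM hτ), ← hτo]; exact hnn τ (hM hτ)
      have hD : ∀ n, Anc n τ.node → f n = Val.dir := fun n hn => hf.2 _ _ hn hτi
      obtain ⟨i, hi⟩ := Set.mem_iUnion.1 (hM hσ)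
      obtain ⟨g, gv, g1, g2⟩ := hg i
      rw [← Relation.reflTransGen_swap]
      refine chain _ hσ hτ huniq hst ?_ ?_
      · intro n hn1 hn2
        have hgn : g n = Val.empty := by
          by_contra hcon
          apply hd
          rw [← (g1 σ hi).2]
          exact gv.2 _ _ hn1 hcon
        obtain ⟨ρ, hρ, rfl⟩ := g2 n (by rw [hgn, hD n hn2]; simp)
        have hρU : ρ ∈ ⋃ i, A i := Set.mem_iUnion.2 ⟨i, hρ⟩
        have hρo : ρ.out = Val.empty := by rw [← (g1 ρ hρ).2, hgn]
        refine ⟨ρ, hmem ρ hρU ?_, rfl⟩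
        rintro μ hμ ⟨hne, h | h | h⟩
        · apply hne
          apply hext _ _ h
          · rw [← hinp ρ hρU, ← hinp μ (hM hμ), h]
          · rw [hρo]
            by_contra hcon
            exact hanc σ hσ μ hμ (h ▸ hn1) hd (Ne.symm hcon)
        · exact hanc σ hσ μ hμ (Anc.of_pre_anc hn1.1 h.1) hd h.2.2
        · exact h.2.2 hρo
      · intro ρ hρ ρ' hρ' h1 h2 hp
        have ha' : Anc σ.node ρ'.node := Anc.of_pre_anc h1 (Anc.of_parent hp)
        have ha : Anc ρ.node τ.node := Anc.of_anc_pre (Anc.of_parent hp) h2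
        have ho : ρ'.out = Val.empty := by
          by_contra hcon
          exact hanc σ hσ ρ' hρ' ha' hd hcon
        have hi' : ρ.inp = Val.dir := by rw [← hinp ρ (hM hρ), hD _ ha]
        refine ⟨hρ', hρ, Or.inl ⟨hp, ho, ?_, hi', ?_⟩⟩
        · rw [← ho]; exact hnn ρ' (hM hρ')
        · rw [← hi']; exact (hnn ρ (hM hρ)).symm
  refine ⟨(Set.finite_iUnion fun i => (hc i).1).subset hM, fun σ hσ => hnn σ (hM hσ), huniq, ?_⟩
  intro σ hσ τ hτ hne hcmp
  rcases hcmp with h | h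
  · exact main σ hσ τ hτ ⟨h, hne⟩
  · exact (main τ hτ σ hσ ⟨h, hne.symm⟩).symm

/-- For jointly refluent canonical sets, `M ⊆ ⋃ i, A i` is a merger iff it is
maximal among conflict-free subsets of `⋃ i, A i`. -/
theorem stmt_11 {N C : Type} [DecidableEq N] {k : ℕ} (A : Fin k → Set (Cmd N C))
    (hc : ∀ i, Canonical (A i)) (hr : JointlyRefluent A)
    (M : Set (Cmd N C)) (hM : M ⊆ ⋃ i, A i) :
    Merger A M ↔
      ((∀ σ ∈ M, ∀ τ ∈ M, ¬ Conflict σ τ) ∧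
       ∀ M' : Set (Cmd N C), M ⊆ M' → M' ⊆ (⋃ i, A i) →
         (∀ σ ∈ M', ∀ τ ∈ M', ¬ Conflict σ τ) → M' = M) := by
  constructor
  · rintro ⟨_, hcan, hmax⟩
    refine ⟨canonical_free hcan, ?_⟩
    intro M' h1 h2 h3
    have hfin : (⋃ i, A i).Finite := Set.finite_iUnion fun i => (hc i).1
    let S : Set (Set (Cmd N C)) :=
      {X | X ⊆ (⋃ i, A i) ∧ ∀ σ ∈ X, ∀ τ ∈ X, ¬ Conflict σ τ}
    have hSfin : S.Finite := hfin.finite_subsets.subset fun X hX => hX.1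
    obtain ⟨X, hMX, hX⟩ := hSfin.exists_le_maximal (show M' ∈ S from ⟨h2, h3⟩)
    have hXc : Canonical X := maximal_canonical A hc hr X hX.prop.1 hX.prop.2 (by
      intro Y a b c
      exact Set.Subset.antisymm (hX.le_of_ge (show Y ∈ S from ⟨b, c⟩) a) a)
    have hXM : X = M := hmax X (h1.trans hMX) hX.prop.1 hXc
    exact Set.Subset.antisymm (hXM ▸ hMX) h1
  · rintro ⟨hfree, hmax⟩
    refine ⟨hM, maximal_canonical A hc hr M hM hfree hmax, ?_⟩
    intro M' h1 h2 h3
    exact hmax M' h1 h2 (canonical_free h3)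

end FileSync
end

section
/- Let A₁, …, A_k be canonical command sets none of which breaks the filesystem FS, and let M be a merger of A₁, …, A_k. Then M does not break FS. -/
namespace FileSync

variable {N C : Type} [DecidableEq N]

theorem anc_iff {m n : Node N} : Anc m n ↔ m.1 <+: n.1 ∧ m.1.length < n.1.length := by
  constructor
  · rintro ⟨h1, h2⟩
    refine ⟨h1, lt_of_le_of_ne h1.length_le ?_⟩
    intro h
    exact h2 (Subtype.ext (h1.eq_of_length h))
  · rintro ⟨h1, h2⟩
    refine ⟨h1, ?_⟩
    rintro rfl
    exact lt_irrefl _ h2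

theorem anc_trans {a b c : Node N} (h1 : Anc a b) (h2 : Anc b c) : Anc a c := by
  rw [anc_iff] at *
  exact ⟨h1.1.trans h2.1, h1.2.trans h2.2⟩

theorem par_anc {p n : Node N} (h : IsParent p n) : Anc p n := by
  obtain ⟨a, ha⟩ := h
  rw [anc_iff, ha]
  exact ⟨List.prefix_append _ _, by simp⟩

theorem par_len {p n : Node N} (h : IsParent p n) : n.1.length = p.1.length + 1 := by
  obtain ⟨a, ha⟩ := h
  simp [ha]

theorem anc_total {a b n : Node N} (h1 : Anc a n) (h2 : Anc b n) :
    a = b ∨ Anc a b ∨ Anc b a := by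
  rcases lt_trichotomy a.1.length b.1.length with h | h | h
  · exact Or.inr (Or.inl (anc_iff.2 ⟨List.prefix_of_prefix_length_le h1.1 h2.1 h.le, h⟩))
  · exact Or.inl (Subtype.ext
      ((List.prefix_of_prefix_length_le h1.1 h2.1 h.le).eq_of_length h))
  · exact Or.inr (Or.inr (anc_iff.2 ⟨List.prefix_of_prefix_length_le h2.1 h1.1 h.le, h⟩))

theorem anc_of_par {p n m : Node N} (h : IsParent p n) (h1 : Anc m n) : m = p ∨ Anc m p := by
  rcases anc_total h1 (par_anc h) with h2 | h2 | h2
  · exact Or.inl h2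
  · exact Or.inr h2
  · have := par_len h
    rw [anc_iff] at h1 h2
    omega

theorem exists_parent {m n : Node N} (h : Anc m n) : ∃ p, IsParent p n := by
  have hl := (anc_iff.1 h).2
  have hm : 0 < m.1.length := List.length_pos_iff.2 m.2
  refine ⟨⟨n.1.dropLast, ?_⟩, n.1.getLast n.2, ?_⟩
  · intro h0
    have := congrArg List.length h0
    simp at this
    omega
  · simp [List.dropLast_append_getLast]

theorem exists_child {m n : Node N} (h : Anc m n) : ∃ c, IsParent m c ∧ (c = n ∨ Anc c n) := by
  obtain ⟨⟨t, ht⟩, hne⟩ := h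
  cases t with
  | nil => exact absurd (Subtype.ext (by simpa using ht)) hne
  | cons a t =>
    refine ⟨⟨m.1 ++ [a], by simp⟩, ⟨a, rfl⟩, ?_⟩
    by_cases h : (⟨m.1 ++ [a], by simp⟩ : Node N) = n
    · exact Or.inl h
    · exact Or.inr ⟨⟨t, by simpa using ht⟩, h⟩

/-- The chain relation inside a set. -/
def CR (A : Set (Cmd N C)) (a b : Cmd N C) : Prop := a ∈ A ∧ b ∈ A ∧ LL a b

/-- chain going up from `σ` to `τ` -/
def UpC (A : Set (Cmd N C)) (σ τ : Cmd N C) : Prop :=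
  Anc τ.node σ.node ∧ σ.out = Val.empty ∧ σ.inp ≠ Val.empty ∧
      τ.inp = Val.dir ∧ τ.out ≠ Val.dir ∧
      ∀ m, Anc τ.node m → Anc m σ.node → ∃ ρ ∈ A, ρ.node = m

/-- chain going down from `σ` to `τ` -/
def DownC (A : Set (Cmd N C)) (σ τ : Cmd N C) : Prop :=
  Anc σ.node τ.node ∧ σ.out = Val.dir ∧ σ.inp ≠ Val.dir ∧
      τ.inp = Val.empty ∧ τ.out ≠ Val.empty ∧
      ∀ m, Anc σ.node m → Anc m τ.node → ∃ ρ ∈ A, ρ.node = m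

theorem chain_cases {A : Set (Cmd N C)} {σ τ : Cmd N C}
    (h : Relation.ReflTransGen (fun a b => a ∈ A ∧ b ∈ A ∧ LL a b) σ τ) :
    σ = τ ∨ UpC A σ τ ∨ DownC A σ τ := by
  induction h with
  | refl => exact Or.inl rfl
  | @tail b c _ hbc ih =>
    obtain ⟨hb, hc, hl⟩ := hbc
    rcases ih with rfl | ih | ih
    · rcases hl with ⟨h1, h2⟩ | ⟨h1, h2⟩
      · refine Or.inr (Or.inl ⟨par_anc h1, h2.1, h2.2.1, h2.2.2.1, h2.2.2.2, ?_⟩)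
        intro m hm hm'
        have := par_len h1
        rw [anc_iff] at hm hm'
        omega
      · refine Or.inr (Or.inr ⟨par_anc h1, h2.1, h2.2.1, h2.2.2.1, h2.2.2.2, ?_⟩)
        intro m hm hm'
        have := par_len h1
        rw [anc_iff] at hm hm'
        omega
    · obtain ⟨a1, a2, a3, a4, a5, a6⟩ := ih
      rcases hl with ⟨h1, h2⟩ | ⟨h1, h2⟩
      · refine Or.inr (Or.inl ⟨anc_trans (par_anc h1) a1, a2, a3, h2.2.2.1, h2.2.2.2, ?_⟩)
        intro m hm hm'
        rcases anc_total hm' a1 with h | h | h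
        · exact ⟨b, hb, h.symm⟩
        · have := par_len h1
          rw [anc_iff] at hm h
          omega
        · exact a6 m h hm'
      · exact absurd h2.1 a5
    · obtain ⟨a1, a2, a3, a4, a5, a6⟩ := ih
      rcases hl with ⟨h1, h2⟩ | ⟨h1, h2⟩
      · exact absurd a4 h2.2.1
      · refine Or.inr (Or.inr ⟨anc_trans a1 (par_anc h1), a2, a3, h2.2.2.1, h2.2.2.2, ?_⟩)
        intro m hm hm'
        rcases anc_of_par h1 hm' with h | h
        · exact ⟨b, hb, h.symm⟩
        · exact a6 m hm h

theorem anc_asymm {a b : Node N} (h : Anc a b) (h' : Anc b a) : False := by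
  rw [anc_iff] at *
  omega

/-- Two commands of a canonical set, `σ` above `τ`. -/
theorem canon_cases {M : Set (Cmd N C)} (hM : Canonical M) {σ τ : Cmd N C}
    (hσ : σ ∈ M) (hτ : τ ∈ M) (h : Anc σ.node τ.node) :
    (DownC M σ τ ∧ Relation.ReflTransGen (fun a b => a ∈ M ∧ b ∈ M ∧ LL a b) σ τ) ∨
    (UpC M τ σ ∧ Relation.ReflTransGen (fun a b => a ∈ M ∧ b ∈ M ∧ LL a b) τ σ) := by
  have hne : σ ≠ τ := fun e => h.2 (by rw [e])
  rcases hM.2.2.2 σ hσ τ hτ h.2 (Or.inl h.1) with hr | hr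
  · rcases chain_cases hr with e | e | e
    · exact absurd e hne
    · exact (anc_asymm h e.1).elim
    · exact Or.inl ⟨e, hr⟩
  · rcases chain_cases hr with e | e | e
    · exact absurd e.symm hne
    · exact Or.inr ⟨e, hr⟩
    · exact (anc_asymm h e.1).elim

theorem canon_mid {M : Set (Cmd N C)} (hM : Canonical M) {σ τ : Cmd N C}
    (hσ : σ ∈ M) (hτ : τ ∈ M) {m : Node N} (h1 : Anc σ.node m) (h2 : Anc m τ.node) :
    ∃ ρ ∈ M, ρ.node = m := by
  rcases canon_cases hM hσ hτ (anc_trans h1 h2) with h | h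
  · exact h.1.2.2.2.2.2 m h1 h2
  · exact h.1.2.2.2.2.2 m h1 h2

theorem sub_before {l1 l2 : List (Cmd N C)} {a b : Cmd N C}
    (hn : (l1 ++ b :: l2).Nodup) (h : List.Sublist [a, b] (l1 ++ b :: l2)) : a ∈ l1 := by
  have hb1 : b ∉ l1 := by grind
  have hb2 : b ∉ l2 := by grind
  rw [List.sublist_append_iff] at h
  obtain ⟨r1, r2, e, h1, h2⟩ := h
  cases r1 with
  | nil =>
    simp only [List.nil_append] at e
    subst e
    cases h2 with
    | cons _ h => exact absurd (h.subset (by simp)) hb2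
    | cons_cons _ h => exact absurd (h.subset (by simp)) hb2
  | cons x r1 =>
    have : a = x := by simp at e; exact e.1
    subst this
    exact h1.subset (by simp)

theorem chain_before {M : Set (Cmd N C)} {l1 l2 : List (Cmd N C)} {σ τ : Cmd N C}
    (ho : Orders M (l1 ++ τ :: l2))
    (h : Relation.ReflTransGen (fun a b => a ∈ M ∧ b ∈ M ∧ LL a b) σ τ) :
    σ = τ ∨ σ ∈ l1 := by
  induction h using Relation.ReflTransGen.head_induction_on with
  | refl => exact Or.inl rfl
  | head hab _ ih =>
    rename_i a b _
    obtain ⟨ha, hb, hl⟩ := hab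
    have hs := ho.2.2 a ((ho.2.1 a).2 ha) b ((ho.2.1 b).2 hb) hl
    right
    rcases ih with rfl | ih
    · exact sub_before ho.1 hs
    · obtain ⟨s, t, rfl⟩ := List.append_of_mem ih
      have hn := ho.1
      simp only [List.append_assoc, List.cons_append] at hs hn
      have := sub_before hn hs
      simp [this]

theorem seqOK_split {l1 l2 : List (Cmd N C)} {σ : Cmd N C} {f : Node N → Val C}
    (h : SeqOK (l1 ++ σ :: l2) f) :
    ∃ g, ValidFS (upd g σ) ∧ g σ.node = σ.inp ∧
      ∀ n, g n = f n ∨ ∃ ρ ∈ l1, ρ.node = n ∧ ρ.out = g n := by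
  induction l1 generalizing f with
  | nil => exact ⟨f, h.2.1, h.1, fun n => Or.inl rfl⟩
  | cons a l ih =>
    obtain ⟨g, h1, h2, h3⟩ := ih h.2.2
    refine ⟨g, h1, h2, fun n => ?_⟩
    rcases h3 n with h4 | ⟨ρ, hρ, h4⟩
    · by_cases hn : n = a.node
      · right
        refine ⟨a, by simp, hn.symm, ?_⟩
        rw [h4]
        simp [upd, hn]
      · left
        rw [h4]
        simp [upd, hn]
    · exact Or.inr ⟨ρ, by simp [hρ], h4⟩

/-- What non-breaking gives for one canonical set. -/
theorem nobreak_facts {A : Set (Cmd N C)} {f : Node N → Val C} (hA : Canonical A)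
    (h : SetNoBreak A f) {σ : Cmd N C} (hσ : σ ∈ A) :
    f σ.node = σ.inp ∧
    (∀ m, Anc m σ.node → σ.out ≠ Val.empty → f m ≠ Val.dir →
      ∃ ρ ∈ A, ρ.node = m ∧ ρ.out = Val.dir) ∧
    (∀ q, Anc σ.node q → σ.out ≠ Val.dir → f q ≠ Val.empty →
      ∃ ρ ∈ A, ρ.node = q ∧ ρ.out = Val.empty) := by
  obtain ⟨⟨α, ho⟩, hall⟩ := h
  have hok := hall α ho
  obtain ⟨l1, l2, rfl⟩ := List.append_of_mem ((ho.2.1 σ).2 hσ)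
  obtain ⟨g, hv, hi, hg⟩ := seqOK_split hok
  have hl : ∀ ρ ∈ l1, ρ ∈ A := fun ρ hρ => (ho.2.1 ρ).1 (by simp [hρ])
  have hn : σ ∉ l1 := by
    have := ho.1
    grind
  refine ⟨?_, ?_, ?_⟩
  · rcases hg σ.node with h | ⟨ρ, hρ, h, _⟩
    · rw [← h, hi]
    · have := hA.2.2.1 ρ (hl ρ hρ) σ hσ h
      exact absurd (this ▸ hρ) hn
  · intro m hm hout hfm
    have h1 : upd g σ m = Val.dir := hv.2 σ.node m hm (by simpa [upd] using hout)
    have h2 : g m = Val.dir := by simpa [upd, hm.2] using h1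
    rcases hg m with h | ⟨ρ, hρ, h, h'⟩
    · exact absurd (h ▸ h2) hfm
    · exact ⟨ρ, hl ρ hρ, h, h'.trans h2⟩
  · intro q hq hout hfq
    have h2 : g q = Val.empty := by
      by_contra hne
      have := hv.2 q σ.node hq (by simpa [upd, hq.2.symm] using hne)
      exact hout (by simpa [upd] using this)
    rcases hg q with h | ⟨ρ, hρ, h, h'⟩
    · exact absurd (h ▸ h2) hfq
    · exact ⟨ρ, hl ρ hρ, h, h'.trans h2⟩

/-- Adding one connected command keeps canonicity. -/
theorem canon_insert {M : Set (Cmd N C)} (hM : Canonical M) {ρ : Cmd N C}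
    (hne : ρ.inp ≠ ρ.out) (hnode : ∀ τ ∈ M, τ.node ≠ ρ.node)
    (hcon : ∀ τ ∈ M, NodesComparable ρ.node τ.node →
      Relation.ReflTransGen (fun a b => a ∈ insert ρ M ∧ b ∈ insert ρ M ∧ LL a b) ρ τ) :
    Canonical (insert ρ M) := by
  obtain ⟨h1, h2, h3, h4⟩ := hM
  have mono : ∀ σ τ, Relation.ReflTransGen (fun a b => a ∈ M ∧ b ∈ M ∧ LL a b) σ τ →
      Relation.ReflTransGen (fun a b => a ∈ insert ρ M ∧ b ∈ insert ρ M ∧ LL a b) σ τ := by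
    intro σ τ h
    exact Relation.ReflTransGen.mono
      (fun a b hab => ⟨Or.inr hab.1, Or.inr hab.2.1, hab.2.2⟩) _ _ h
  refine ⟨h1.insert ρ, ?_, ?_, ?_⟩
  · rintro σ (rfl | hσ)
    · exact hne
    · exact h2 σ hσ
  · rintro σ (rfl | hσ) τ (rfl | hτ) h
    · rfl
    · exact absurd h.symm (hnode τ hτ)
    · exact absurd h (hnode σ hσ)
    · exact h3 σ hσ τ hτ h
  · rintro σ (rfl | hσ) τ (rfl | hτ) h hc
    · exact absurd rfl h
    · exact Or.inl (hcon τ hτ hc)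
    · exact Or.inr (hcon σ hσ hc.symm)
    · exact (h4 σ hσ τ hτ h hc).imp (mono _ _) (mono _ _)

theorem canon_insert' {M : Set (Cmd N C)} (hM : Canonical M) {ρ : Cmd N C}
    (hne : ρ.inp ≠ ρ.out) (hnode : ∀ τ ∈ M, τ.node ≠ ρ.node)
    (hcon : ∀ τ ∈ M, Anc ρ.node τ.node ∨ Anc τ.node ρ.node →
      ∃ τ' ∈ M, LL ρ τ' ∧
        Relation.ReflTransGen (fun a b => a ∈ M ∧ b ∈ M ∧ LL a b) τ' τ) :
    Canonical (insert ρ M) := by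
  refine canon_insert hM hne hnode ?_
  intro τ hτ hc
  have : Anc ρ.node τ.node ∨ Anc τ.node ρ.node :=
    hc.imp (fun h => ⟨h, (hnode τ hτ).symm⟩) (fun h => ⟨h, hnode τ hτ⟩)
  obtain ⟨τ', h1, h2, h3⟩ := hcon τ hτ this
  refine Relation.ReflTransGen.head ⟨Or.inl rfl, Or.inr h1, h2⟩ ?_
  exact Relation.ReflTransGen.mono
      (fun a b hab => ⟨Or.inr hab.1, Or.inr hab.2.1, hab.2.2⟩) _ _ h3

section merger
variable {k : ℕ} {A : Fin k → Set (Cmd N C)} {f : Node N → Val C} {M : Set (Cmd N C)}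

theorem merger_no_insert (hM : Merger A M) {ρ : Cmd N C} {i : Fin k} (hρ : ρ ∈ A i)
    (hc : Canonical (insert ρ M)) : ρ ∈ M := by
  have := hM.2.2 (insert ρ M) (Set.subset_insert _ _)
    (Set.insert_subset (Set.mem_iUnion.2 ⟨i, hρ⟩) hM.1) hc
  rw [← this]
  exact Set.mem_insert _ _

theorem merger_inp (hc : ∀ i, Canonical (A i)) (h : ∀ i, SetNoBreak (A i) f)
    (hM : Merger A M) {σ : Cmd N C} (hσ : σ ∈ M) : f σ.node = σ.inp := by
  obtain ⟨i, hi⟩ := Set.mem_iUnion.1 (hM.1 hσ)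
  exact (nobreak_facts (hc i) (h i) hi).1

/-- Nodes at which a directory has to be made are mentioned in the merger. -/
theorem merger_above (hc : ∀ i, Canonical (A i)) (hf : ValidFS f)
    (h : ∀ i, SetNoBreak (A i) f) (hM : Merger A M) (d : ℕ) :
    ∀ m : Node N, ∀ τ ∈ M, Anc m τ.node → f m ≠ Val.dir →
      (∀ σ ∈ M, σ.node.1.length ≤ m.1.length + d) → ∃ ρ ∈ M, ρ.node = m := by
  induction d with
  | zero =>
    intro m τ hτ hm _ hd
    have := hd τ hτ
    rw [anc_iff] at hm
    omega
  | succ d ih =>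
    intro m τ hτ hm hfm hd
    by_contra hno
    push Not at hno
    have below : ∀ q, Anc m q → f q = Val.empty := by
      intro q hq
      by_contra hne
      exact hfm (hf.2 q m hq hne)
    have inpE : ∀ τ ∈ M, Anc m τ.node → τ.inp = Val.empty := by
      intro τ hτ hm
      rw [← merger_inp hc h hM hτ, below _ hm]
    have outE : ∀ τ ∈ M, Anc m τ.node → τ.out ≠ Val.empty := by
      intro τ hτ hm e
      exact hM.2.1.2.1 τ hτ (by rw [inpE τ hτ hm, e])
    obtain ⟨i, hi⟩ := Set.mem_iUnion.1 (hM.1 hτ)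
    obtain ⟨ρ, hρ, rfl, hρo⟩ := (nobreak_facts (hc i) (h i) hi).2.1 m hm (outE τ hτ hm) hfm
    have hρi := (nobreak_facts (hc i) (h i) hρ).1
    refine hno ρ (merger_no_insert hM hρ ?_) rfl
    refine canon_insert' hM.2.1 ((hc i).2.1 ρ hρ) hno ?_
    rintro π hπ (hq | hq)
    · obtain ⟨c, hpc, hcq⟩ := exists_child hq
      have hx : ∃ τ' ∈ M, τ'.node = c := by
        rcases hcq with rfl | hcq
        · exact ⟨π, hπ, rfl⟩
        · refine ih c π hπ hcq (by rw [below c (par_anc hpc)]; simp) ?_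
          intro σ hσ
          have := hd σ hσ
          have := par_len hpc
          omega
      obtain ⟨τ', hτ', rfl⟩ := hx
      refine ⟨τ', hτ', Or.inr ⟨hpc, hρo, hρi ▸ hfm, inpE τ' hτ' (par_anc hpc),
        outE τ' hτ' (par_anc hpc)⟩, ?_⟩
      rcases hcq with e | hcq
      · rw [hM.2.1.2.2.1 τ' hτ' π hπ e]
      · rcases canon_cases hM.2.1 hτ' hπ hcq with hh | hh
        · exact hh.2
        · exact absurd (inpE π hπ hq) hh.1.2.2.1
    · obtain ⟨ρ', h1, h2⟩ := canon_mid hM.2.1 hπ hτ hq hm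
      exact absurd h2 (hno ρ' h1)

/-- Nodes which have to be emptied are mentioned in the merger. -/
theorem merger_below (hc : ∀ i, Canonical (A i)) (hf : ValidFS f)
    (h : ∀ i, SetNoBreak (A i) f) (hM : Merger A M) (d : ℕ) :
    ∀ q : Node N, q.1.length = d → ∀ σ ∈ M, Anc σ.node q → σ.out ≠ Val.dir →
      f q ≠ Val.empty → ∃ ρ ∈ M, ρ.node = q := by
  induction d with
  | zero =>
    intro q hd σ hσ hq
    rw [anc_iff] at hq
    omega
  | succ d ih =>
    intro q hd σ hσ hq hout hfq
    by_contra hno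
    push Not at hno
    have inpD : ∀ τ ∈ M, Anc τ.node q → τ.inp = Val.dir := by
      intro τ hτ hm
      rw [← merger_inp hc h hM hτ, hf.2 _ _ hm hfq]
    obtain ⟨i, hi⟩ := Set.mem_iUnion.1 (hM.1 hσ)
    obtain ⟨ρ, hρ, rfl, hρo⟩ := (nobreak_facts (hc i) (h i) hi).2.2 q hq hout hfq
    have hρi := (nobreak_facts (hc i) (h i) hρ).1
    obtain ⟨p, hp⟩ := exists_parent hq
    have hpx : ∃ τ' ∈ M, τ'.node = p ∧ τ'.out ≠ Val.dir := by
      rcases anc_of_par hp hq with e | hpa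
      · exact ⟨σ, hσ, e, hout⟩
      · obtain ⟨τ', hτ', rfl⟩ := ih p (by have := par_len hp; omega) σ hσ hpa hout
          (by rw [hf.2 _ _ (par_anc hp) hfq]; simp)
        refine ⟨τ', hτ', rfl, ?_⟩
        rcases canon_cases hM.2.1 hσ hτ' hpa with hh | hh
        · exact absurd hh.1.2.1 hout
        · rw [hh.1.2.1]; simp
    obtain ⟨τ', hτ', rfl, ho'⟩ := hpx
    refine hno ρ (merger_no_insert hM hρ ?_) rfl
    refine canon_insert' hM.2.1 ((hc i).2.1 ρ hρ) hno ?_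
    rintro π hπ (hr | hr)
    · obtain ⟨ρ', h1, h2⟩ := canon_mid hM.2.1 hσ hπ hq hr
      exact absurd h2 (hno ρ' h1)
    · refine ⟨τ', hτ', Or.inl ⟨hp, hρo, hρi ▸ hfq, inpD τ' hτ' (par_anc hp), ho'⟩, ?_⟩
      rcases anc_of_par hp hr with e | hcq
      · rw [hM.2.1.2.2.1 τ' hτ' π hπ e.symm]
      · rcases canon_cases hM.2.1 hπ hτ' hcq with hh | hh
        · have h1 := inpD τ' hτ' (par_anc hp)
          rw [hh.1.2.2.2.1] at h1
          exact absurd h1 (by simp)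
        · exact hh.2

theorem merger_seq (hc : ∀ i, Canonical (A i)) (hf : ValidFS f)
    (h : ∀ i, SetNoBreak (A i) f) (hM : Merger A M) (l2 : List (Cmd N C)) :
    ∀ (l1 : List (Cmd N C)) (g : Node N → Val C), Orders M (l1 ++ l2) → ValidFS g →
      (∀ σ ∈ l1, g σ.node = σ.out) → (∀ n, (∀ σ ∈ l1, σ.node ≠ n) → g n = f n) →
      SeqOK l2 g := by
  induction l2 with
  | nil => intros; trivial
  | cons σ l2 ih =>
    intro l1 g ho hg i1 i2
    have hl : ∀ ρ ∈ l1, ρ ∈ M := fun ρ hρ => (ho.2.1 ρ).1 (by simp [hρ])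
    have hσ : σ ∈ M := (ho.2.1 σ).1 (by simp)
    have hn : σ ∉ l1 := by
      have := ho.1
      grind
    have hnode : ∀ ρ ∈ l1, ρ.node ≠ σ.node := by
      intro ρ hρ e
      exact hn (hM.2.1.2.2.1 ρ (hl ρ hρ) σ hσ e ▸ hρ)
    have hinp : g σ.node = σ.inp := by
      rw [i2 _ hnode, merger_inp hc h hM hσ]
    have stepA : σ.inp = Val.empty → ∀ m, Anc m σ.node → g m = Val.dir := by
      intro he m hm
      have key : ∀ ρ ∈ M, ρ.node = m → ρ.out = Val.dir ∧ ρ ∈ l1 := by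
        rintro ρ hρ rfl
        rcases canon_cases hM.2.1 hρ hσ hm with hh | hh
        · refine ⟨hh.1.2.1, (chain_before ho hh.2).resolve_left ?_⟩
          rintro rfl
          exact hm.2 rfl
        · exact absurd he hh.1.2.2.1
      by_cases hx : ∃ ρ ∈ l1, ρ.node = m
      · obtain ⟨ρ, hρ, rfl⟩ := hx
        rw [i1 ρ hρ, (key ρ (hl ρ hρ) rfl).1]
      · push Not at hx
        rw [i2 m hx]
        by_contra hfm
        obtain ⟨D, hD⟩ : ∃ D, ∀ σ ∈ M, σ.node.1.length ≤ D := by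
          obtain ⟨D, hD⟩ := (hM.2.1.1.image (fun σ => σ.node.1.length)).bddAbove
          exact ⟨D, fun σ hσ => hD ⟨σ, hσ, rfl⟩⟩
        obtain ⟨ρ, hρ, e⟩ := merger_above hc hf h hM D m σ hσ hm hfm
          (fun σ hσ => (hD σ hσ).trans (Nat.le_add_left _ _))
        exact hx ρ (key ρ hρ e).2 e
    have stepB : σ.out ≠ Val.dir → ∀ q, Anc σ.node q → g q = Val.empty := by
      intro he q hq
      have key : ∀ ρ ∈ M, ρ.node = q → ρ.out = Val.empty ∧ ρ ∈ l1 := by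
        rintro ρ hρ rfl
        rcases canon_cases hM.2.1 hσ hρ hq with hh | hh
        · exact absurd hh.1.2.1 he
        · refine ⟨hh.1.2.1, (chain_before ho hh.2).resolve_left ?_⟩
          rintro rfl
          exact hq.2 rfl
      by_cases hx : ∃ ρ ∈ l1, ρ.node = q
      · obtain ⟨ρ, hρ, rfl⟩ := hx
        rw [i1 ρ hρ, (key ρ (hl ρ hρ) rfl).1]
      · push Not at hx
        rw [i2 q hx]
        by_contra hfq
        obtain ⟨ρ, hρ, e⟩ := merger_below hc hf h hM _ q rfl σ hσ hq he hfq
        exact hx ρ (key ρ hρ e).2 e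
    have hv : ValidFS (upd g σ) := by
      refine ⟨(hg.1.insert σ.node).subset ?_, ?_⟩
      · intro n hn
        by_cases e : n = σ.node
        · exact Or.inl e
        · exact Or.inr (by simpa [upd, e] using hn)
      · intro n m hmn hne
        by_cases e : m = σ.node
        · subst e
          have hne' : g n ≠ Val.empty := by simpa [upd, hmn.2.symm] using hne
          by_contra hd
          exact hne' (stepB (by simpa [upd] using hd) n hmn)
        · have : upd g σ m = g m := by simp [upd, e]
          rw [this]
          by_cases e' : n = σ.node
          · subst e'
            by_cases hi : σ.inp = Val.empty
            · exact stepA hi m hmn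
            · exact hg.2 _ m hmn (by rw [hinp]; exact hi)
          · exact hg.2 n m hmn (by simpa [upd, e'] using hne)
    refine ⟨hinp, hv, ih (l1 ++ [σ]) (upd g σ) (by simpa using ho) hv ?_ ?_⟩
    · intro ρ hρ
      rcases List.mem_append.1 hρ with hρ | hρ
      · simp [upd, hnode ρ hρ, i1 ρ hρ]
      · have : ρ = σ := by simpa using hρ
        subst this
        simp [upd]
    · intro n hn'
      have h1 : n ≠ σ.node := fun e => hn' σ (by simp) e.symm
      simp only [upd, h1, if_false]
      exact i2 n (fun ρ hρ => hn' ρ (by simp [hρ]))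

end merger

/-- Sorting key: destructors bottom-up, constructors top-down. -/
def ckey (σ : Cmd N C) : ℤ :=
  if vtype σ.out < vtype σ.inp then - (σ.node.1.length : ℤ) else σ.node.1.length

theorem ckey_lt {σ τ : Cmd N C} (h : LL σ τ) : ckey σ < ckey τ := by
  rcases h with ⟨h1, h2, h3, h4, h5⟩ | ⟨h1, h2, h3, h4, h5⟩
  · have hl := par_len h1
    have a : vtype σ.out < vtype σ.inp := by
      rw [h2]; cases hh : σ.inp <;> simp_all [vtype]
    have b : vtype τ.out < vtype τ.inp := by
      rw [h4]; cases hh : τ.out <;> simp_all [vtype]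
    simp only [ckey, a, b, if_true]
    omega
  · have hl := par_len h1
    have a : ¬ vtype σ.out < vtype σ.inp := by
      rw [h2]; cases hh : σ.inp <;> simp_all [vtype]
    have b : ¬ vtype τ.out < vtype τ.inp := by
      rw [h4]; simp [vtype]
    simp only [ckey, a, b, if_false]
    omega

theorem exists_orders {M : Set (Cmd N C)} (hM : M.Finite) : ∃ α, Orders M α := by
  classical
  let r : Cmd N C → Cmd N C → Prop := fun a b => ckey a ≤ ckey b
  haveI : Std.Total r := ⟨fun a b => le_total _ _⟩
  haveI : IsTrans (Cmd N C) r := ⟨fun a b c h1 h2 => le_trans (α := ℤ) h1 h2⟩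
  let α := hM.toFinset.toList.insertionSort r
  have hp : α.Perm hM.toFinset.toList := List.perm_insertionSort r _
  have hs : α.Pairwise r := List.pairwise_insertionSort r _
  refine ⟨α, hp.nodup_iff.2 (Finset.nodup_toList _), ?_, ?_⟩
  · intro σ
    rw [hp.mem_iff]
    simp
  · intro σ hσ τ hτ hl
    have hlt := ckey_lt hl
    obtain ⟨s, t, e⟩ := List.append_of_mem hσ
    rw [e] at hτ hs ⊢
    have : τ ∈ t := by
      rcases List.mem_append.1 hτ with h | h
      · have := (List.pairwise_append.1 hs).2.2 τ h σ (by simp)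
        exact absurd hlt (not_lt.2 this)
      · rcases List.mem_cons.1 h with h | h
        · subst h
          exact absurd hlt (lt_irrefl _)
        · exact h
    exact List.Sublist.trans ((List.singleton_sublist.2 this).cons_cons σ)
      (List.sublist_append_right _ _)

/-- If none of the canonical sets `A i` breaks `FS` and `M` is a merger of
them, then `M` does not break `FS`. -/
theorem stmt_12 {N C : Type} [DecidableEq N] {k : ℕ} (A : Fin k → Set (Cmd N C))
    (hc : ∀ i, Canonical (A i)) (f : Node N → Val C) (hf : ValidFS f)
    (h : ∀ i, SetNoBreak (A i) f) (M : Set (Cmd N C)) (hM : Merger A M) :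
    SetNoBreak M f := by
  refine ⟨exists_orders hM.2.1.1, fun α ho => ?_⟩
  exact merger_seq hc hf h hM α [] f ho hf (by simp) (by simp)

end FileSync
end
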